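/- Let E be a real inner product space, K ≥ 1, and for each k = 1, …, K let f_k : E → ℝ be convex, differentiable, and L-smooth (L > 0) with a global minimizer w_k* ∈ E. Let λ₁, …, λ_K be nonnegative reals with Σ_k λ_k = 1, let w* ∈ E be a global minimizer of the weighted sum F(x) = Σ_k λ_k f_k(x), and suppose ‖w* − w_k*‖² ≤ ε_w for every k, where ε_w ≥ 0. Let 0 < η ≤ 1/(2L) and set ζ = 2η(1 − 2ηL). Then for any w₁, …, w_K ∈ E with w̄ = Σ_k λ_k w_k: 4Lη² Σ_k λ_k (f_k(w_k) − f_k(w_k*)) − 2η Σ_k λ_k (f_k(w_k) − f_k(w*)) ≤ (ηL²ε_w/2)(ζ + 4η) + (ζ/(2η)) Σ_k λ_k ‖w_k − w̄‖². -/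

import Mathlib

section Gradient

variable {E : Type*} [NormedAddCommGroup E] [InnerProductSpace ℝ E] [CompleteSpace E]

/-- The derivative of a differentiable function along a line. -/
theorem hasDerivAt_comp_line {f : E → ℝ} (hf : Differentiable ℝ f) (x v : E)
    (t : ℝ) :
    HasDerivAt (fun s : ℝ => f (x + s • v)) (inner ℝ (gradient f (x + t • v)) v) t := by
  have hline : HasDerivAt (fun s : ℝ => x + s • v) v t := by
    simpa using ((hasDerivAt_id t).smul_const v).const_add x
  rw [inner_gradient_left]
  exact (hf (x + t • v)).hasFDerivAt.comp_hasDerivAt t hline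

/-- A differentiable convex function lies above its tangent hyperplanes. -/
theorem ConvexOn.add_inner_gradient_le {f : E → ℝ} (hc : ConvexOn ℝ Set.univ f)
    (hf : Differentiable ℝ f) (x y : E) :
    f x + inner ℝ (gradient f x) (y - x) ≤ f y := by
  have hline : ConvexOn ℝ Set.univ (fun s : ℝ => f (x + s • (y - x))) := by
    have h := hc.comp_affineMap (AffineMap.lineMap x y : ℝ →ᵃ[ℝ] E)
    simpa [Function.comp_def, AffineMap.lineMap_apply, add_comm] using h
  have h := hline.le_slope_of_hasDerivAt (Set.mem_univ 0) (Set.mem_univ 1) zero_lt_one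
    (hasDerivAt_comp_line hf x (y - x) 0)
  simp only [slope_def_field, zero_smul, add_zero, one_smul, add_sub_cancel, sub_zero,
    div_one] at h
  linarith

/-- The quadratic upper bound for a function with `L`-Lipschitz gradient. -/
theorem le_add_inner_gradient_add_sq {f : E → ℝ} (hf : Differentiable ℝ f)
    {L : ℝ} (hL : ∀ a b, ‖gradient f a - gradient f b‖ ≤ L * ‖a - b‖) (x y : E) :
    f y ≤ f x + inner ℝ (gradient f x) (y - x) + L / 2 * ‖y - x‖ ^ 2 := by
  set v := y - x with hv
  have hg := hasDerivAt_comp_line hf x v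
  have hB : ∀ t : ℝ, HasDerivAt
      (fun t : ℝ => f x + t * inner ℝ (gradient f x) v + L / 2 * ‖v‖ ^ 2 * t ^ 2)
      (inner ℝ (gradient f x) v + L * ‖v‖ ^ 2 * t) t := fun t => by
    have h := (((hasDerivAt_id t).mul_const (inner ℝ (gradient f x) v)).const_add (f x)).add
      (((hasDerivAt_id t).pow 2).const_mul (L / 2 * ‖v‖ ^ 2))
    refine h.congr_deriv ?_
    simp
    ring
  have h := image_le_of_deriv_right_le_deriv_boundary (a := 0) (b := 1)
    (fun t _ => (hg t).continuousAt.continuousWithinAt)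
    (fun t _ => (hg t).hasDerivWithinAt) (by simp)
    (fun t _ => (hB t).continuousAt.continuousWithinAt)
    (fun t _ => (hB t).hasDerivWithinAt)
    (fun t ht => by
      have h1 : inner ℝ (gradient f (x + t • v) - gradient f x) v ≤ L * ‖v‖ ^ 2 * t :=
        calc inner ℝ (gradient f (x + t • v) - gradient f x) v
            ≤ ‖gradient f (x + t • v) - gradient f x‖ * ‖v‖ := real_inner_le_norm _ _
          _ ≤ L * ‖x + t • v - x‖ * ‖v‖ := by gcongr; exact hL _ _
          _ = L * ‖v‖ ^ 2 * t := by
            rw [add_sub_cancel_left, norm_smul, Real.norm_of_nonneg ht.1]; ring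
      rw [inner_sub_left] at h1
      linarith)
    (Set.right_mem_Icc.2 zero_le_one)
  simpa [hv] using h

/-- The gradient vanishes at a global minimizer. -/
theorem gradient_eq_zero_of_forall_le {f : E → ℝ} {x : E} (h : ∀ y, f x ≤ f y) :
    gradient f x = 0 := by
  have hmin : IsLocalMin f x := Filter.Eventually.of_forall h
  simp [gradient, hmin.fderiv_eq_zero]

/-- First-order optimality for a weighted sum of differentiable functions. -/
theorem sum_smul_gradient_eq_zero_of_forall_le {ι : Type*} [Fintype ι] {f : ι → E → ℝ}
    (hf : ∀ k, Differentiable ℝ (f k)) {c : ι → ℝ} {x : E}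
    (h : ∀ y, ∑ k, c k * f k x ≤ ∑ k, c k * f k y) :
    ∑ k, c k • gradient (f k) x = 0 := by
  have hmin : IsLocalMin (fun y => ∑ k, c k * f k y) x := Filter.Eventually.of_forall h
  have hd := hmin.hasFDerivAt_eq_zero
    (HasFDerivAt.fun_sum fun k _ => ((hf k x).hasFDerivAt.const_mul (c k)))
  simpa [gradient, map_sum, map_smulₛₗ] using
    congrArg (InnerProductSpace.toDual ℝ E).symm hd

/-- A weighted Jensen-type gap at a minimizer of `Σ c k * f k`, controlled by the gradients there
and the spread of the points. -/
theorem sum_mul_sub_le_of_forall_le {ι : Type*} [Fintype ι] {f : ι → E → ℝ}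
    (hc : ∀ k, ConvexOn ℝ Set.univ (f k)) (hf : ∀ k, Differentiable ℝ (f k))
    {c : ι → ℝ} (hc0 : ∀ k, 0 ≤ c k) {x : E}
    (h : ∀ y, ∑ k, c k * f k x ≤ ∑ k, c k * f k y) {η : ℝ} (hη : 0 < η) (w : ι → E) (z : E) :
    ∑ k, c k * (f k x - f k (w k)) ≤
      ∑ k, c k * (η / 2 * ‖gradient (f k) x‖ ^ 2) + 1 / (2 * η) * ∑ k, c k * ‖w k - z‖ ^ 2 := by
  have h0 : ∑ k, c k * inner ℝ (gradient (f k) x) (z - x) = 0 := by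
    have hs := congrArg (fun u => inner ℝ u (z - x)) (sum_smul_gradient_eq_zero_of_forall_le hf h)
    simpa [sum_inner, real_inner_smul_left] using hs
  have hk : ∀ k, f k x - f k (w k) ≤ η / 2 * ‖gradient (f k) x‖ ^ 2
      + 1 / (2 * η) * ‖w k - z‖ ^ 2 - inner ℝ (gradient (f k) x) (z - x) := fun k => by
    have h1 := (hc k).add_inner_gradient_le (hf k) x (w k)
    have h2 : inner ℝ (gradient (f k) x) (w k - x) =
        inner ℝ (gradient (f k) x) (w k - z) + inner ℝ (gradient (f k) x) (z - x) := by
      rw [← inner_add_right, sub_add_sub_cancel]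
    have h3 := neg_le_of_abs_le (abs_real_inner_le_norm (gradient (f k) x) (w k - z))
    have h4 : ‖gradient (f k) x‖ * ‖w k - z‖ ≤
        η / 2 * ‖gradient (f k) x‖ ^ 2 + 1 / (2 * η) * ‖w k - z‖ ^ 2 := by
      have h5 : η / 2 * ‖gradient (f k) x‖ ^ 2 + 1 / (2 * η) * ‖w k - z‖ ^ 2
          - ‖gradient (f k) x‖ * ‖w k - z‖
          = 1 / (2 * η) * (η * ‖gradient (f k) x‖ - ‖w k - z‖) ^ 2 := by
        field_simp
        ring
      have h6 : 0 ≤ 1 / (2 * η) * (η * ‖gradient (f k) x‖ - ‖w k - z‖) ^ 2 := by positivity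
      linarith
    linarith
  have hsum := Finset.sum_le_sum fun k (_ : k ∈ Finset.univ) =>
    mul_le_mul_of_nonneg_left (hk k) (hc0 k)
  simp only [mul_sub (c _) (_ + _), mul_add, Finset.sum_sub_distrib, Finset.sum_add_distrib, h0,
    mul_left_comm (c _) (1 / (2 * η)), ← Finset.mul_sum, sub_zero] at hsum
  exact hsum

end Gradient

/-- A convex combination of numbers bounded by `b` is bounded by `b`. -/
theorem sum_mul_le_of_forall_le {ι : Type*} [Fintype ι] {c a : ι → ℝ} {b : ℝ}
    (hc0 : ∀ k, 0 ≤ c k) (hc1 : ∑ k, c k = 1) (h : ∀ k, a k ≤ b) : ∑ k, c k * a k ≤ b :=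
  calc ∑ k, c k * a k ≤ ∑ k, c k * b :=
        Finset.sum_le_sum fun k _ => mul_le_mul_of_nonneg_left (h k) (hc0 k)
    _ = b := by rw [← Finset.sum_mul, hc1, one_mul]

/-- Lemma 2 (the B₃ bound): for convex, differentiable, `L`-smooth `f k` with global
minimizers `wstar k`, convex weights `lam k`, a global minimizer `wopt` of
`F = Σ_k lam k * f k`, `‖wopt − wstar k‖² ≤ ε_w`, and `0 < η ≤ 1/(2L)` with
`ζ = 2η(1 − 2ηL)`:
`4Lη² Σ_k lam k (f_k(w k) − f_k(wstar k)) − 2η Σ_k lam k (f_k(w k) − f_k(wopt))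
  ≤ (ηL²ε_w/2)(ζ + 4η) + (ζ/(2η)) Σ_k lam k ‖w k − wbar‖²`. -/
theorem stmt_8 {E : Type*} [NormedAddCommGroup E] [InnerProductSpace ℝ E] [CompleteSpace E]
    (K : ℕ) (hK : 1 ≤ K) (f : Fin K → E → ℝ) (L : ℝ) (hL : 0 < L)
    (hconv : ∀ k, ConvexOn ℝ Set.univ (f k))
    (hdiff : ∀ k, Differentiable ℝ (f k))
    (hsmooth : ∀ k, ∀ a b : E, ‖gradient (f k) a - gradient (f k) b‖ ≤ L * ‖a - b‖)
    (wstar : Fin K → E) (hmin : ∀ k, ∀ x : E, f k (wstar k) ≤ f k x)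
    (lam : Fin K → ℝ) (hlam : ∀ k, 0 ≤ lam k) (hsum : ∑ k, lam k = 1)
    (wopt : E) (hopt : ∀ x : E, ∑ k, lam k * f k wopt ≤ ∑ k, lam k * f k x)
    (εw : ℝ) (hεw : 0 ≤ εw) (hdev : ∀ k, ‖wopt - wstar k‖ ^ 2 ≤ εw)
    (η : ℝ) (hη : 0 < η) (hη2 : η ≤ 1 / (2 * L))
    (ζ : ℝ) (hζ : ζ = 2 * η * (1 - 2 * η * L))
    (w : Fin K → E) (wbar : E) (hwbar : wbar = ∑ k, lam k • w k) :
    4 * L * η ^ 2 * (∑ k, lam k * (f k (w k) - f k (wstar k))) -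
        2 * η * (∑ k, lam k * (f k (w k) - f k wopt)) ≤
      (η * L ^ 2 * εw / 2) * (ζ + 4 * η) + (ζ / (2 * η)) * ∑ k, lam k * ‖w k - wbar‖ ^ 2 := by
  have hζ0 : 0 ≤ ζ := by
    rw [le_div_iff₀ (by positivity)] at hη2
    rw [hζ]
    exact mul_nonneg (by positivity) (by linarith)
  have hgrad0 : ∀ k, gradient (f k) (wstar k) = 0 := fun k =>
    gradient_eq_zero_of_forall_le (hmin k)
  have hgap : ∑ k, lam k * (f k wopt - f k (wstar k)) ≤ L / 2 * εw :=
    sum_mul_le_of_forall_le hlam hsum fun k => by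
      have h := le_add_inner_gradient_add_sq (hdiff k) (hsmooth k) (wstar k) wopt
      rw [hgrad0, inner_zero_left] at h
      have := mul_le_mul_of_nonneg_left (hdev k) (half_pos hL).le
      linarith
  have hgrad : ∑ k, lam k * (η / 2 * ‖gradient (f k) wopt‖ ^ 2) ≤ η / 2 * (L ^ 2 * εw) :=
    sum_mul_le_of_forall_le hlam hsum fun k => by
      have h := hsmooth k wopt (wstar k)
      rw [hgrad0, sub_zero] at h
      gcongr
      calc ‖gradient (f k) wopt‖ ^ 2 ≤ (L * ‖wopt - wstar k‖) ^ 2 := by gcongr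
        _ = L ^ 2 * ‖wopt - wstar k‖ ^ 2 := mul_pow _ _ _
        _ ≤ L ^ 2 * εw := by gcongr; exact hdev k
  have hvar := sum_mul_sub_le_of_forall_le hconv hdiff hlam hopt hη w wbar
  have h1 := mul_le_mul_of_nonneg_left (hvar.trans (add_le_add_left hgrad _)) hζ0
  have h2 := mul_le_mul_of_nonneg_left hgap (by positivity : 0 ≤ 4 * L * η ^ 2)
  have hV : ζ / (2 * η) * ∑ k, lam k * ‖w k - wbar‖ ^ 2 =
      ζ * (1 / (2 * η) * ∑ k, lam k * ‖w k - wbar‖ ^ 2) := by ring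
  rw [hV]
  simp only [mul_sub (lam _), Finset.sum_sub_distrib] at h1 h2 ⊢
  have h4 : 4 * L * η ^ 2 = 2 * η - ζ := by rw [hζ]; ring
  have h5 : η * L ^ 2 * εw / 2 * (4 * η) = 4 * L * η ^ 2 * (L / 2 * εw) := by ring
  rw [mul_add _ ζ, h5]
  rw [h4] at h2 ⊢
  linarith
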